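/- (Holroyd–Johnson conjecture.) Let n, k and r be positive integers satisfying n ≥ (k+1)r, and let 𝒜 ⊆ [n]^(r)_k be an intersecting family of k-separated r-subsets of [n]. Then |𝒜| ≤ binomial(n−kr−1, r−1), which equals the size of the family {A ∈ [n]^(r)_k : 1 ∈ A}. -/

import Mathlib

/-- The family of all `k`-separated `r`-subsets of `[n] = {1,…,n}`:
`A = {a₁ < … < a_r} ⊆ [n]` with consecutive circular gaps all `> k`.
Equivalently (for nonempty `A`): `k < n` and every pair `a < b` in `A`
satisfies `b - a > k` and `(a + n) - b > k`. -/
def sepSets (n k r : ℕ) : Finset (Finset ℕ) :=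
  (Finset.Icc 1 n).powerset.filter fun A =>
    A.card = r ∧ k < n ∧ ∀ a ∈ A, ∀ b ∈ A, a < b → k < b - a ∧ b - a + k < n

/-- A family of sets is intersecting if any two members meet. -/
def Intersecting (𝒜 : Finset (Finset ℕ)) : Prop :=
  ∀ A ∈ 𝒜, ∀ B ∈ 𝒜, (A ∩ B).Nonempty

theorem mem_sep {n k r : ℕ} {A : Finset ℕ} : A ∈ sepSets n k r ↔
    (∀ a ∈ A, 1 ≤ a ∧ a ≤ n) ∧ A.card = r ∧ k < n ∧
      ∀ a ∈ A, ∀ b ∈ A, a < b → k < b - a ∧ b - a + k < n := by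
  unfold sepSets
  rw [Finset.mem_filter, Finset.mem_powerset]
  constructor
  · rintro ⟨h1, h2⟩
    exact ⟨fun a ha => Finset.mem_Icc.1 (h1 ha), h2⟩
  · rintro ⟨h1, h2⟩
    exact ⟨fun a ha => Finset.mem_Icc.2 (h1 a ha), h2⟩

/-- contraction of `k+1` and `k+2`. -/
def fC (k x : ℕ) : ℕ := if x ≤ k + 1 then x else x - 1

/-- contraction by `k+1`. -/
def hC (k x : ℕ) : ℕ := if x ≤ k + 1 then x else x - (k + 1)

/-- remove the elements in `[k+2, 2k+2]`. -/
def dC (k : ℕ) (A : Finset ℕ) : Finset ℕ := A.filter fun x => x ≤ k + 1 ∨ 2 * k + 2 < x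

/-- Contains a bad pair. -/
def BadP (k : ℕ) (A : Finset ℕ) : Prop := ∃ i ∈ A, i ≤ k + 1 ∧ i + (k + 1) ∈ A

/-- Collides with another member. -/
def Coll (k : ℕ) (𝒜 : Finset (Finset ℕ)) (A : Finset ℕ) : Prop :=
  k + 2 ∈ A ∧ insert (k + 1) (A.erase (k + 2)) ∈ 𝒜

theorem choose_rec (n k r : ℕ) (hr : 2 ≤ r) (hn : 2 * k + 2 ≤ n) :
    (n - 1 - k * r - 1).choose (r - 1) + (n - k - 1 - k * (r - 1) - 1).choose (r - 1 - 1) =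
      (n - k * r - 1).choose (r - 1) := by
  obtain ⟨s, rfl⟩ : ∃ s, r = s + 2 := ⟨r - 2, by omega⟩
  have e : k * (s + 2) = k * (s + 1) + k := by ring
  have e1 : s + 2 - 1 = s + 1 := rfl
  simp only [e1, Nat.add_sub_cancel]
  have h2 : n - k - 1 - k * (s + 1) - 1 = n - k * (s + 2) - 1 - 1 := by omega
  have h1 : n - 1 - k * (s + 2) - 1 = n - k * (s + 2) - 1 - 1 := by omega
  rw [h1, h2]
  rcases Nat.eq_zero_or_pos (n - k * (s + 2) - 1) with h0 | h0
  · rcases Nat.eq_zero_or_pos s with hs | hs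
    · subst hs; omega
    · obtain ⟨t, rfl⟩ : ∃ t, s = t + 1 := ⟨s - 1, by omega⟩
      rw [h0]; simp
  · obtain ⟨N, hN⟩ : ∃ N, n - k * (s + 2) - 1 = N + 1 := ⟨n - k * (s + 2) - 1 - 1, by omega⟩
    rw [hN, Nat.add_sub_cancel, Nat.choose_succ_succ, Nat.add_comm]

theorem sep_two {n k r : ℕ} (hr : 2 ≤ r) {A : Finset ℕ} (hA : A ∈ sepSets n k r) :
    2 * k + 2 ≤ n := by
  obtain ⟨h1, h2, h3, h4⟩ := mem_sep.1 hA
  obtain ⟨a, ha, b, hb, hab⟩ := Finset.one_lt_card.1 (show 1 < A.card by omega)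
  rcases lt_or_gt_of_ne hab with h | h
  · have := h4 a ha b hb h; omega
  · have := h4 b hb a ha h; omega

theorem choose_small (n k r : ℕ) (hr : 2 ≤ r) (hn : n < 2 * k + 2) :
    (n - k * r - 1).choose (r - 1) = 0 := by
  have : k * 2 ≤ k * r := Nat.mul_le_mul_left k hr
  apply Nat.choose_eq_zero_of_lt
  omega

theorem star_count (k : ℕ) (n r : ℕ) (hr : 1 ≤ r) (hn : k < n) :
    ((sepSets n k r).filter fun A => 1 ∈ A).card = (n - k * r - 1).choose (r - 1) := by
  induction n using Nat.strong_induction_on generalizing r with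
  | _ n ih =>
  rcases Nat.lt_or_ge r 2 with hr2 | hr2
  · obtain rfl : r = 1 := by omega
    simp only [Nat.sub_self, Nat.choose_zero_right]
    rw [Finset.card_eq_one]
    refine ⟨{1}, ?_⟩
    ext A
    rw [Finset.mem_filter, mem_sep, Finset.mem_singleton]
    constructor
    · rintro ⟨⟨-, h2, -⟩, h⟩
      obtain ⟨a, rfl⟩ := Finset.card_eq_one.1 h2
      simp at h; rw [h]
    · rintro rfl
      simp; omega
  rcases Nat.lt_or_ge n (2 * k + 2) with hn2 | hn2
  · rw [choose_small n k r hr2 hn2, Finset.card_eq_zero, Finset.filter_eq_empty_iff]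
    intro A hA
    have := sep_two hr2 hA
    omega
  rw [← choose_rec n k r hr2 hn2, ← ih (n - 1) (by omega) r hr (by omega),
    ← ih (n - k - 1) (by omega) (r - 1) (by omega) (by omega),
    ← Finset.card_filter_add_card_filter_not (fun A => n - k ∉ A)]
  congr 1
  · congr 1
    ext A
    simp only [Finset.mem_filter, mem_sep]
    constructor
    · rintro ⟨⟨⟨h1, h2, h3, h4⟩, h5⟩, h6⟩
      have key : ∀ a ∈ A, a + k + 1 ≤ n := by
        intro a ha
        have := h1 a ha
        have h7 : a ≠ n - k := fun h => h6 (h ▸ ha)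
        by_cases h : 1 < a
        · have := h4 1 h5 a ha h; omega
        · omega
      refine ⟨⟨fun a ha => ?_, h2, by omega, fun a ha b hb hab => ?_⟩, h5⟩
      · have := h1 a ha; have := key a ha; omega
      · have := h1 a ha; have := key b hb; have := h4 a ha b hb hab; omega
    · rintro ⟨⟨h1, h2, h3, h4⟩, h5⟩
      refine ⟨⟨⟨fun a ha => ?_, h2, by omega, fun a ha b hb hab => ?_⟩, h5⟩, ?_⟩
      · have := h1 a ha; omega
      · have := h4 a ha b hb hab; omega
      · intro h
        have := h4 1 h5 _ h (by omega); omega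
  · refine Finset.card_bij' (fun A _ => A.erase (n - k)) (fun A _ => insert (n - k) A) ?_ ?_ ?_ ?_
    · intro A
      simp only [Finset.mem_filter, mem_sep, not_not]
      rintro ⟨⟨⟨h1, h2, h3, h4⟩, h5⟩, h6⟩
      have key : ∀ a ∈ A, a ≠ n - k → a + 2 * k + 1 ≤ n := by
        intro a ha hne
        have := h1 a ha
        have h8 : a ≤ n - k := by
          by_cases h : 1 < a
          · have := h4 1 h5 a ha h; omega
          · omega
        have := h4 a ha _ h6 (by omega)
        omega
      refine ⟨⟨fun a ha => ?_, ?_, by omega, fun a ha b hb hab => ?_⟩, ?_⟩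
      · rw [Finset.mem_erase] at ha
        have := h1 a ha.2; have := key a ha.2 ha.1; omega
      · rw [Finset.card_erase_of_mem h6, h2]
      · rw [Finset.mem_erase] at ha hb
        have := h1 a ha.2; have := key b hb.2 hb.1; have := h4 a ha.2 b hb.2 hab; omega
      · rw [Finset.mem_erase]; exact ⟨by omega, h5⟩
    · intro A
      simp only [Finset.mem_filter, mem_sep, not_not]
      rintro ⟨⟨h1, h2, h3, h4⟩, h5⟩
      have key : ∀ a ∈ A, a + 2 * k + 1 ≤ n := by
        intro a ha
        have := h1 a ha
        by_cases h : 1 < a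
        · have := h4 1 h5 a ha h; omega
        · omega
      have hno : n - k ∉ A := fun h => by have := key _ h; omega
      refine ⟨⟨⟨fun a ha => ?_, ?_, by omega, fun a ha b hb hab => ?_⟩, ?_⟩, ?_⟩
      · rw [Finset.mem_insert] at ha
        rcases ha with rfl | ha
        · omega
        · have := h1 a ha; omega
      · rw [Finset.card_insert_of_notMem hno, h2]; omega
      · rw [Finset.mem_insert] at ha hb
        rcases ha with rfl | ha <;> rcases hb with rfl | hb
        · omega
        · have := key b hb; omega
        · have := key a ha; have := h1 a ha; omega
        · have := h4 a ha b hb hab; omega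
      · exact Finset.mem_insert_of_mem h5
      · exact Finset.mem_insert_self _ _
    · intro A
      simp only [Finset.mem_filter, not_not]
      rintro ⟨_, h6⟩
      exact Finset.insert_erase h6
    · intro A
      simp only [Finset.mem_filter, mem_sep]
      rintro ⟨⟨h1, h2, h3, h4⟩, h5⟩
      apply Finset.erase_insert
      intro h
      have := h4 1 h5 _ h (by omega)
      omega

theorem fC_card {k : ℕ} {A : Finset ℕ} {n r : ℕ} (hk : 1 ≤ k) (hA : A ∈ sepSets n k r) :
    Set.InjOn (fC k) A := by
  obtain ⟨h1, h2, h3, h4⟩ := mem_sep.1 hA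
  intro a ha b hb hab
  rcases lt_trichotomy a b with h | h | h
  · have := h4 a ha b hb h
    unfold fC at hab; split_ifs at hab <;> omega
  · exact h
  · have := h4 b hb a ha h
    unfold fC at hab; split_ifs at hab <;> omega

theorem fC_sep {n k r : ℕ} {A : Finset ℕ} (hk : 1 ≤ k) (hn : 2 * k + 2 ≤ n)
    (hA : A ∈ sepSets n k r) (hb : ¬ BadP k A) : A.image (fC k) ∈ sepSets (n - 1) k r := by
  have hinj := fC_card hk hA
  obtain ⟨h1, h2, h3, h4⟩ := mem_sep.1 hA
  rw [mem_sep]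
  refine ⟨?_, ?_, by omega, ?_⟩
  · intro a ha
    obtain ⟨x, hx, rfl⟩ := Finset.mem_image.1 ha
    have := h1 x hx
    unfold fC; split_ifs <;> omega
  · rw [Finset.card_image_of_injOn hinj, h2]
  · intro a ha b hb' hab
    obtain ⟨x, hx, rfl⟩ := Finset.mem_image.1 ha
    obtain ⟨y, hy, rfl⟩ := Finset.mem_image.1 hb'
    have hxy : x < y := by
      unfold fC at hab; split_ifs at hab <;> omega
    have := h4 x hx y hy hxy
    have := h1 x hx
    have := h1 y hy
    have hne : x ≤ k + 1 → y ≠ x + (k + 1) := by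
      rintro h rfl
      exact hb ⟨x, hx, h, hy⟩
    unfold fC; split_ifs <;> omega

theorem fC_coll {n k r : ℕ} {A B : Finset ℕ} (hk : 1 ≤ k)
    (hA : A ∈ sepSets n k r) (hB : B ∈ sepSets n k r) (h : A.image (fC k) = B.image (fC k))
    (ha : k + 1 ∈ A) (hb : k + 2 ∈ B) : A = insert (k + 1) (B.erase (k + 2)) := by
  obtain ⟨-, -, -, hA4⟩ := mem_sep.1 hA
  obtain ⟨-, -, -, hB4⟩ := mem_sep.1 hB
  have h1 : k + 2 ∉ A := fun h => by have := hA4 _ ha _ h (by omega); omega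
  have h2 : k + 1 ∉ B := fun h => by have := hB4 _ h _ hb (by omega); omega
  have aux : ∀ C D : Finset ℕ, C.image (fC k) = D.image (fC k) → ∀ x ∈ C, x ≠ k + 1 → x ≠ k + 2 →
      x ∈ D := by
    intro C D hCD x hx n1 n2
    have : fC k x ∈ D.image (fC k) := hCD ▸ Finset.mem_image_of_mem _ hx
    obtain ⟨y, hy, hxy⟩ := Finset.mem_image.1 this
    have : y = x := by
      unfold fC at hxy; split_ifs at hxy <;> omega
    exact this ▸ hy
  ext x
  rw [Finset.mem_insert, Finset.mem_erase]
  constructor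
  · intro hx
    by_cases e : x = k + 1
    · exact Or.inl e
    · have e2 : x ≠ k + 2 := fun e => h1 (e ▸ hx)
      exact Or.inr ⟨e2, aux A B h x hx e e2⟩
  · rintro (rfl | ⟨e2, hx⟩)
    · exact ha
    · exact aux B A h.symm x hx (fun e => h2 (e ▸ hx)) e2

theorem fC_inj {n k r : ℕ} {𝒜 : Finset (Finset ℕ)} (hk : 1 ≤ k) (h𝒜 : 𝒜 ⊆ sepSets n k r)
    {A B : Finset ℕ} (hA : A ∈ 𝒜) (hB : B ∈ 𝒜) (hcA : ¬ Coll k 𝒜 A) (hcB : ¬ Coll k 𝒜 B)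
    (h : A.image (fC k) = B.image (fC k)) : A = B := by
  have sub : ∀ A B : Finset ℕ, A ∈ 𝒜 → B ∈ 𝒜 → ¬ Coll k 𝒜 A → ¬ Coll k 𝒜 B →
      A.image (fC k) = B.image (fC k) → A ⊆ B := by
    intro A B hA hB hcA hcB h x hx
    have : fC k x ∈ B.image (fC k) := h ▸ Finset.mem_image_of_mem _ hx
    obtain ⟨y, hy, hxy⟩ := Finset.mem_image.1 this
    have : y = x ∨ (x = k + 1 ∧ y = k + 2) ∨ (x = k + 2 ∧ y = k + 1) := by
      unfold fC at hxy; split_ifs at hxy <;> omega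
    rcases this with rfl | ⟨rfl, rfl⟩ | ⟨rfl, rfl⟩
    · exact hy
    · exact absurd ⟨hy, fC_coll hk (h𝒜 hA) (h𝒜 hB) h hx hy ▸ hA⟩ hcB
    · exact absurd ⟨hx, fC_coll hk (h𝒜 hB) (h𝒜 hA) h.symm hy hx ▸ hB⟩ hcA
  exact Finset.Subset.antisymm (sub A B hA hB hcA hcB h) (sub B A hB hA hcB hcA h.symm)

/-- Structure of special sets: a unique removed element `p`. -/
theorem special {n k r : ℕ} {𝒜 : Finset (Finset ℕ)} (hk : 1 ≤ k) (h𝒜 : 𝒜 ⊆ sepSets n k r)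
    {A : Finset ℕ} (hA : A ∈ 𝒜) (hs : BadP k A ∨ Coll k 𝒜 A) :
    (∃ i, 1 ≤ i ∧ i ≤ k + 1 ∧ i ∈ A ∧ i + (k + 1) ∈ A ∧ dC k A = A.erase (i + (k + 1)) ∧
      ∀ x ∈ A, x ≠ i → x ≠ i + (k + 1) → i + 2 * k + 2 ≤ x ∧ x + k + 1 ≤ n + i) ∨
    (Coll k 𝒜 A ∧ k + 2 ∈ A ∧ dC k A = A.erase (k + 2) ∧
      ∀ x ∈ A, x ≠ k + 2 → 2 * k + 3 ≤ x ∧ x ≤ n) := by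
  obtain ⟨h1, h2, h3, h4⟩ := mem_sep.1 (h𝒜 hA)
  rcases hs with ⟨i, hi, hik, hi2⟩ | hc
  · left
    have key : ∀ x ∈ A, x ≠ i → x ≠ i + (k + 1) → i + 2 * k + 2 ≤ x ∧ x + k + 1 ≤ n + i := by
      intro x hx n1 n2
      have := h1 x hx
      have := h1 i hi
      have := h4 x hx _ hi
      have := h4 _ hi x hx
      have := h4 x hx _ hi2
      have := h4 _ hi2 x hx
      omega
    refine ⟨i, (h1 i hi).1, hik, hi, hi2, ?_, key⟩
    ext x
    rw [dC, Finset.mem_filter, Finset.mem_erase]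
    constructor
    · rintro ⟨hx, h⟩
      have := h1 i hi
      exact ⟨by omega, hx⟩
    · rintro ⟨hne, hx⟩
      refine ⟨hx, ?_⟩
      have := h1 i hi
      by_cases e : x = i
      · omega
      · have := key x hx e hne; omega
  · right
    obtain ⟨c1, c2⟩ := hc
    obtain ⟨h1', h2', h3', h4'⟩ := mem_sep.1 (h𝒜 c2)
    have key : ∀ x ∈ A, x ≠ k + 2 → 2 * k + 3 ≤ x ∧ x ≤ n := by
      intro x hx hne
      have := h1 x hx
      have := h4 x hx _ c1
      have := h4 _ c1 x hx
      have hx' : x ∈ insert (k + 1) (A.erase (k + 2)) :=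
        Finset.mem_insert_of_mem (Finset.mem_erase.2 ⟨hne, hx⟩)
      have := h4' x hx' _ (Finset.mem_insert_self _ _)
      omega
    refine ⟨⟨c1, c2⟩, c1, ?_, key⟩
    ext x
    rw [dC, Finset.mem_filter, Finset.mem_erase]
    constructor
    · rintro ⟨hx, h⟩
      exact ⟨by omega, hx⟩
    · rintro ⟨hne, hx⟩
      have := key x hx hne
      exact ⟨hx, by omega⟩

theorem hC_inj {k x y : ℕ} (hx : x ≤ k + 1 ∨ 2 * k + 2 < x) (hy : y ≤ k + 1 ∨ 2 * k + 2 < y)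
    (h : hC k x = hC k y) : x = y := by
  unfold hC at h; split_ifs at h <;> omega

theorem hC_image {k : ℕ} {A B : Finset ℕ} (h : (dC k A).image (hC k) = (dC k B).image (hC k)) :
    dC k A ⊆ dC k B := by
  intro x hx
  have : hC k x ∈ (dC k B).image (hC k) := h ▸ Finset.mem_image_of_mem _ hx
  obtain ⟨y, hy, hxy⟩ := Finset.mem_image.1 this
  have := hC_inj (Finset.mem_filter.1 hy).2 (Finset.mem_filter.1 hx).2 hxy
  exact this ▸ hy

theorem spec_inj {n k r : ℕ} {𝒜 : Finset (Finset ℕ)} (hk : 1 ≤ k) (h𝒜 : 𝒜 ⊆ sepSets n k r)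
    {A B : Finset ℕ} (hA : A ∈ 𝒜) (hB : B ∈ 𝒜) (hsA : BadP k A ∨ Coll k 𝒜 A)
    (hsB : BadP k B ∨ Coll k 𝒜 B)
    (h : (dC k A).image (hC k) = (dC k B).image (hC k)) : A = B := by
  have hd : dC k A = dC k B := Finset.Subset.antisymm (hC_image h) (hC_image h.symm)
  rcases special hk h𝒜 hA hsA with ⟨i, i1, i2, i3, i4, i5, i6⟩ | ⟨-, i3, i5, i6⟩ <;>
  rcases special hk h𝒜 hB hsB with ⟨j, j1, j2, j3, j4, j5, j6⟩ | ⟨-, j3, j5, j6⟩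
  · have hi : i ∈ dC k A := Finset.mem_filter.2 ⟨i3, Or.inl i2⟩
    rw [hd] at hi
    have hiB := (Finset.mem_filter.1 hi).1
    have : i = j := by
      by_contra hne
      have := j6 i hiB hne (by omega)
      omega
    subst this
    rw [← Finset.insert_erase i4, ← Finset.insert_erase j4, ← i5, ← j5, hd]
  · have hi : i ∈ dC k A := Finset.mem_filter.2 ⟨i3, Or.inl i2⟩
    rw [hd] at hi
    have := j6 i (Finset.mem_filter.1 hi).1 (by omega)
    omega
  · have hj : j ∈ dC k B := Finset.mem_filter.2 ⟨j3, Or.inl j2⟩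
    rw [← hd] at hj
    have := i6 j (Finset.mem_filter.1 hj).1 (by omega)
    omega
  · rw [← Finset.insert_erase i3, ← Finset.insert_erase j3, ← i5, ← j5, hd]

theorem spec_sep {n k r : ℕ} {𝒜 : Finset (Finset ℕ)} (hk : 1 ≤ k) (h𝒜 : 𝒜 ⊆ sepSets n k r)
    (hn : 2 * k + 2 ≤ n)
    {A : Finset ℕ} (hA : A ∈ 𝒜) (hsA : BadP k A ∨ Coll k 𝒜 A) :
    (dC k A).image (hC k) ∈ sepSets (n - k - 1) k (r - 1) := by
  obtain ⟨h1, h2, h3, h4⟩ := mem_sep.1 (h𝒜 hA)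
  have hinj : Set.InjOn (hC k) (dC k A) := fun x hx y hy hxy =>
    hC_inj (Finset.mem_filter.1 hx).2 (Finset.mem_filter.1 hy).2 hxy
  rw [mem_sep]
  refine ⟨?_, ?_, by omega, ?_⟩
  · intro a ha
    obtain ⟨x, hx, rfl⟩ := Finset.mem_image.1 ha
    obtain ⟨hx, hx'⟩ := Finset.mem_filter.1 hx
    have := h1 x hx
    unfold hC; split_ifs <;> omega
  · rw [Finset.card_image_of_injOn hinj]
    rcases special hk h𝒜 hA hsA with ⟨i, i1, i2, i3, i4, i5, i6⟩ | ⟨-, i3, i5, i6⟩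
    · rw [i5, Finset.card_erase_of_mem i4, h2]
    · rw [i5, Finset.card_erase_of_mem i3, h2]
  · intro a ha b hb' hab
    obtain ⟨x, hx, rfl⟩ := Finset.mem_image.1 ha
    obtain ⟨y, hy, rfl⟩ := Finset.mem_image.1 hb'
    obtain ⟨hx, hx'⟩ := Finset.mem_filter.1 hx
    obtain ⟨hy, hy'⟩ := Finset.mem_filter.1 hy
    have hxy : x < y := by
      unfold hC at hab; split_ifs at hab <;> omega
    have := h4 x hx y hy hxy
    have := h1 x hx
    have := h1 y hy
    rcases special hk h𝒜 hA hsA with ⟨i, i1, i2, i3, i4, i5, i6⟩ | ⟨-, i3, i5, i6⟩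
    · have := i6 x hx
      have := i6 y hy
      unfold hC; split_ifs <;> omega
    · have := i6 x hx
      have := i6 y hy
      unfold hC; split_ifs <;> omega

theorem coll_int {n k : ℕ} {𝒜 : Finset (Finset ℕ)}
    (hint : Intersecting 𝒜) {A B : Finset ℕ} (hA : A ∈ 𝒜)
    (hB : Coll k 𝒜 B) (hkB : ∀ x ∈ B, x ≠ k + 2 → 2 * k + 3 ≤ x ∧ x ≤ n)
    (hkA : k + 1 ∉ A) : (dC k A ∩ dC k B).Nonempty := by
  obtain ⟨y, hy⟩ := hint A hA _ hB.2
  rw [Finset.mem_inter, Finset.mem_insert, Finset.mem_erase] at hy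
  obtain ⟨hyA, rfl | ⟨hne, hyB⟩⟩ := hy
  · exact absurd hyA hkA
  · have := hkB y hyB hne
    exact ⟨y, Finset.mem_inter.2 ⟨Finset.mem_filter.2 ⟨hyA, by omega⟩,
      Finset.mem_filter.2 ⟨hyB, by omega⟩⟩⟩

theorem spec_int {n k r : ℕ} {𝒜 : Finset (Finset ℕ)} (h𝒜 : 𝒜 ⊆ sepSets n k r) (hk : 1 ≤ k)
    (hint : Intersecting 𝒜) {A B : Finset ℕ} (hA : A ∈ 𝒜) (hB : B ∈ 𝒜)
    (hsA : BadP k A ∨ Coll k 𝒜 A) (hsB : BadP k B ∨ Coll k 𝒜 B) :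
    (dC k A ∩ dC k B).Nonempty := by
  obtain ⟨x, hx⟩ := hint A hA B hB
  obtain ⟨xA, xB⟩ := Finset.mem_inter.1 hx
  by_cases hw : x ≤ k + 1 ∨ 2 * k + 2 < x
  · exact ⟨x, Finset.mem_inter.2 ⟨Finset.mem_filter.2 ⟨xA, hw⟩, Finset.mem_filter.2 ⟨xB, hw⟩⟩⟩
  rcases special hk h𝒜 hA hsA with ⟨i, i1, i2, i3, i4, i5, i6⟩ | ⟨cA, i3, i5, i6⟩ <;>
  rcases special hk h𝒜 hB hsB with ⟨j, j1, j2, j3, j4, j5, j6⟩ | ⟨cB, j3, j5, j6⟩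
  · have := i6 x xA
    have := j6 x xB
    have : i = j := by omega
    subst this
    exact ⟨i, Finset.mem_inter.2 ⟨Finset.mem_filter.2 ⟨i3, Or.inl i2⟩,
      Finset.mem_filter.2 ⟨j3, Or.inl i2⟩⟩⟩
  · refine coll_int hint hA cB j6 fun h => ?_
    have := i6 x xA
    have := j6 x xB
    have := i6 _ h
    omega
  · rw [Finset.inter_comm]
    refine coll_int hint hB cA i6 fun h => ?_
    have := i6 x xA
    have := j6 x xB
    have := j6 _ h
    omega
  · refine coll_int hint hA cB j6 fun h => ?_
    have := i6 _ h
    omega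

open Classical in
theorem bound (k : ℕ) (hk : 1 ≤ k) (n r : ℕ) (hr : 1 ≤ r)
    (𝒜 : Finset (Finset ℕ)) (h𝒜 : 𝒜 ⊆ sepSets n k r) (hint : Intersecting 𝒜) :
    𝒜.card ≤ (n - k * r - 1).choose (r - 1) := by
  induction n using Nat.strong_induction_on generalizing r 𝒜 with
  | _ n ih =>
  rcases Nat.lt_or_ge r 2 with hr2 | hr2
  · obtain rfl : r = 1 := by omega
    simp only [Nat.sub_self, Nat.choose_zero_right]
    rw [Finset.card_le_one]
    intro A hA B hB
    obtain ⟨a, rfl⟩ := Finset.card_eq_one.1 (mem_sep.1 (h𝒜 hA)).2.1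
    obtain ⟨b, rfl⟩ := Finset.card_eq_one.1 (mem_sep.1 (h𝒜 hB)).2.1
    obtain ⟨x, hx⟩ := hint _ hA _ hB
    simp only [Finset.mem_inter, Finset.mem_singleton] at hx
    rw [← hx.1, ← hx.2]
  rcases Finset.eq_empty_or_nonempty 𝒜 with rfl | ⟨A₀, hA₀⟩
  · simp
  have hn2 := sep_two hr2 (h𝒜 hA₀)
  rw [← choose_rec n k r hr2 hn2,
    ← Finset.card_filter_add_card_filter_not (fun A => ¬ (BadP k A ∨ Coll k 𝒜 A))]
  apply Nat.add_le_add
  · rw [← Finset.card_image_of_injOn (f := fun A => A.image (fC k))]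
    · apply ih (n - 1) (by omega) r hr
      · intro C hC'
        obtain ⟨A, hA, rfl⟩ := Finset.mem_image.1 hC'
        obtain ⟨hA, hs⟩ := Finset.mem_filter.1 hA
        exact fC_sep hk hn2 (h𝒜 hA) fun h => hs (Or.inl h)
      · intro C hC' D hD
        obtain ⟨A, hA, rfl⟩ := Finset.mem_image.1 hC'
        obtain ⟨B, hB, rfl⟩ := Finset.mem_image.1 hD
        obtain ⟨x, hx⟩ := hint A (Finset.mem_filter.1 hA).1 B (Finset.mem_filter.1 hB).1
        obtain ⟨xA, xB⟩ := Finset.mem_inter.1 hx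
        exact ⟨fC k x, Finset.mem_inter.2
          ⟨Finset.mem_image_of_mem _ xA, Finset.mem_image_of_mem _ xB⟩⟩
    · intro A hA B hB h
      obtain ⟨hA, hsA⟩ := Finset.mem_filter.1 hA
      obtain ⟨hB, hsB⟩ := Finset.mem_filter.1 hB
      exact fC_inj hk h𝒜 hA hB (fun h => hsA (Or.inr h)) (fun h => hsB (Or.inr h)) h
  · simp only [not_not]
    rw [← Finset.card_image_of_injOn (f := fun A => (dC k A).image (hC k))]
    · apply ih (n - k - 1) (by omega) (r - 1) (by omega)
      · intro C hC'
        obtain ⟨A, hA, rfl⟩ := Finset.mem_image.1 hC'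
        obtain ⟨hA, hs⟩ := Finset.mem_filter.1 hA
        exact spec_sep hk h𝒜 hn2 hA hs
      · intro C hC' D hD
        obtain ⟨A, hA, rfl⟩ := Finset.mem_image.1 hC'
        obtain ⟨B, hB, rfl⟩ := Finset.mem_image.1 hD
        obtain ⟨hA, hsA⟩ := Finset.mem_filter.1 hA
        obtain ⟨hB, hsB⟩ := Finset.mem_filter.1 hB
        obtain ⟨x, hx⟩ := spec_int h𝒜 hk hint hA hB hsA hsB
        obtain ⟨xA, xB⟩ := Finset.mem_inter.1 hx
        exact ⟨hC k x, Finset.mem_inter.2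
          ⟨Finset.mem_image_of_mem _ xA, Finset.mem_image_of_mem _ xB⟩⟩
    · intro A hA B hB h
      obtain ⟨hA, hsA⟩ := Finset.mem_filter.1 hA
      obtain ⟨hB, hsB⟩ := Finset.mem_filter.1 hB
      exact spec_inj hk h𝒜 hA hB hsA hsB h

theorem stmt3 (n k r : ℕ) (hk : 1 ≤ k) (hr : 1 ≤ r) (hn : (k + 1) * r ≤ n)
    (𝒜 : Finset (Finset ℕ)) (h𝒜 : 𝒜 ⊆ sepSets n k r) (hint : Intersecting 𝒜) :
    𝒜.card ≤ (n - k * r - 1).choose (r - 1) ∧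
      ((sepSets n k r).filter fun A => 1 ∈ A).card = (n - k * r - 1).choose (r - 1) := by
  refine ⟨bound k hk n r hr 𝒜 h𝒜 hint, star_count k n r hr ?_⟩
  have : (k + 1) * 1 ≤ (k + 1) * r := Nat.mul_le_mul_left _ hr
  omega
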